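/- Let n and m be positive integers. If there exists a Whitney-maximum graph in C_{n,m}, then every uniformly most reliable graph in C_{n,m} is a 0-element in C_{n,m}. -/

import Mathlib

open MvPolynomial

/-- Number of connected components of the spanning subgraph of a graph on `Fin n`
whose edge set is `s`. -/
noncomputable def ncomp (n : ℕ) (s : Set (Sym2 (Fin n))) : ℕ :=
  Nat.card (SimpleGraph.fromEdgeSet s).ConnectedComponent

/-- `G` is a member of `C_{n,m}`: a connected simple graph on `n` vertices and `m` edges. -/
def IsCnm (n m : ℕ) (G : SimpleGraph (Fin n)) : Prop :=
  G.Connected ∧ G.edgeSet.ncard = m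

/-- `N_i^{(k)}(G)`: the number of spanning subgraphs of `G` (identified with subsets of
`E(G)`) having exactly `i` edges and at most `k` connected components. -/
noncomputable def Ncnt (n : ℕ) (G : SimpleGraph (Fin n)) (i k : ℕ) : ℕ :=
  Set.ncard {s : Set (Sym2 (Fin n)) | s ⊆ G.edgeSet ∧ s.ncard = i ∧ ncomp n s ≤ k}

/-- `N_{i,j}(G)`: the number of spanning subgraphs of `G` having exactly `i` edges and
exactly `j` connected components. -/
noncomputable def Nexact (n : ℕ) (G : SimpleGraph (Fin n)) (i j : ℕ) : ℕ :=
  Set.ncard {s : Set (Sym2 (Fin n)) | s ⊆ G.edgeSet ∧ s.ncard = i ∧ ncomp n s = j}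

/-- The `k`-reliability of `G` at `p`: `R_G^{(k)}(p) = Σ_{i=0}^m N_i^{(k)}(G) p^i (1-p)^{m-i}`. -/
noncomputable def rel (n m : ℕ) (G : SimpleGraph (Fin n)) (k : ℕ) (p : ℝ) : ℝ :=
  ∑ i ∈ Finset.range (m + 1), (Ncnt n G i k : ℝ) * p ^ i * (1 - p) ^ (m - i)

/-- The Tutte polynomial of `G`, `T_G(x,y) = Σ_{H ∈ S(G)} (x-1)^{r(G)-r(H)} (y-1)^{c(H)}`,
where the rank of the spanning subgraph with edge set `s` is `n - ncomp n s`, so that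
`r(G) - r(H) = ncomp n s - ncomp n G.edgeSet`, and the corank is `s.ncard + ncomp n s - n`. -/
noncomputable def tutte (n : ℕ) (G : SimpleGraph (Fin n)) : MvPolynomial (Fin 2) ℝ :=
  ∑ᶠ s ∈ {t : Set (Sym2 (Fin n)) | t ⊆ G.edgeSet},
    (X 0 - 1) ^ (ncomp n s - ncomp n G.edgeSet) * (X 1 - 1) ^ (s.ncard + ncomp n s - n)

/-- The Whitney polynomial of `G`, `W_G(x,y) = Σ_{H ∈ S(G)} x^{r(G)-r(H)} y^{c(H)}`. -/
noncomputable def whitney (n : ℕ) (G : SimpleGraph (Fin n)) : MvPolynomial (Fin 2) ℝ :=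
  ∑ᶠ s ∈ {t : Set (Sym2 (Fin n)) | t ⊆ G.edgeSet},
    X 0 ^ (ncomp n s - ncomp n G.edgeSet) * X 1 ^ (s.ncard + ncomp n s - n)

/-- A bivariate polynomial is nonnegative if all its coefficients are nonnegative. -/
def NonnegPoly (P : MvPolynomial (Fin 2) ℝ) : Prop :=
  ∀ d : Fin 2 →₀ ℕ, 0 ≤ P.coeff d

/-- `G` is Tutte-maximum in `C_{n,m}`. -/
def TutteMaximum (n m : ℕ) (G : SimpleGraph (Fin n)) : Prop :=
  ∀ H : SimpleGraph (Fin n), IsCnm n m H →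
    ∃ P : MvPolynomial (Fin 2) ℝ, NonnegPoly P ∧
      tutte n G - tutte n H = (X 0 + X 1 - X 0 * X 1) * P

/-- `G` is Whitney-maximum in `C_{n,m}`. -/
def WhitneyMaximum (n m : ℕ) (G : SimpleGraph (Fin n)) : Prop :=
  ∀ H : SimpleGraph (Fin n), IsCnm n m H →
    ∃ Q : MvPolynomial (Fin 2) ℝ, NonnegPoly Q ∧
      whitney n G - whitney n H = (1 - X 0 * X 1) * Q

/-- `G` is strong in `C_{n,m}`. -/
def Strong (n m : ℕ) (G : SimpleGraph (Fin n)) : Prop :=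
  ∀ H : SimpleGraph (Fin n), IsCnm n m H →
    ∀ i ≤ m, ∀ k, 1 ≤ k → k ≤ n → Ncnt n H i k ≤ Ncnt n G i k

/-- `G` is a 0-element in `C_{n,m}`. -/
def ZeroElement (n m : ℕ) (G : SimpleGraph (Fin n)) : Prop :=
  ∀ H : SimpleGraph (Fin n), IsCnm n m H → ∀ i ≤ m, Ncnt n H i 1 ≤ Ncnt n G i 1

/-- `t_k(G)`: the number of spanning forests of `G` composed of exactly `k` trees. -/
noncomputable def tcount (n : ℕ) (G : SimpleGraph (Fin n)) (k : ℕ) : ℕ :=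
  Set.ncard {s : Set (Sym2 (Fin n)) |
    s ⊆ G.edgeSet ∧ (SimpleGraph.fromEdgeSet s).IsAcyclic ∧ ncomp n s = k}

/-- `λ^{(k)}(G)`: the minimum number of edges that must be removed from `G` to obtain a
spanning subgraph with more than `k` connected components. -/
noncomputable def lamk (n : ℕ) (G : SimpleGraph (Fin n)) (k : ℕ) : ℕ :=
  sInf {d : ℕ | ∃ D : Set (Sym2 (Fin n)),
    D ⊆ G.edgeSet ∧ D.ncard = d ∧ k < ncomp n (G.edgeSet \ D)}

/-- `∂^{a+b} P / ∂x^a ∂y^b` evaluated at `(0,0)`. -/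
noncomputable def pdevalXY (P : MvPolynomial (Fin 2) ℝ) (a b : ℕ) : ℝ :=
  MvPolynomial.eval (fun _ => (0 : ℝ))
    ((fun q => MvPolynomial.pderiv (0 : Fin 2) q)^[a]
      ((fun q => MvPolynomial.pderiv (1 : Fin 2) q)^[b] P))

theorem one_le_ncomp {n : ℕ} (hn : 0 < n) (s : Set (Sym2 (Fin n))) : 1 ≤ ncomp n s := by
  have : Nonempty (SimpleGraph.fromEdgeSet s).ConnectedComponent :=
    ⟨(SimpleGraph.fromEdgeSet s).connectedComponentMk ⟨0, hn⟩⟩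
  exact Nat.card_pos

theorem connected_fromEdgeSet_of_ncomp_le_one {n : ℕ} (hn : 0 < n) {s : Set (Sym2 (Fin n))}
    (h : ncomp n s ≤ 1) : (SimpleGraph.fromEdgeSet s).Connected := by
  have : Subsingleton (SimpleGraph.fromEdgeSet s).ConnectedComponent :=
    Finite.card_le_one_iff_subsingleton.1 h
  have : Nonempty (Fin n) := ⟨⟨0, hn⟩⟩
  exact ⟨fun u v => SimpleGraph.ConnectedComponent.exact (Subsingleton.elim _ _)⟩

theorem ncomp_edgeSet_of_connected {n : ℕ} (hn : 0 < n) {G : SimpleGraph (Fin n)}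
    (hG : G.Connected) : ncomp n G.edgeSet = 1 := by
  refine le_antisymm ?_ (one_le_ncomp hn _)
  rw [ncomp, SimpleGraph.fromEdgeSet_edgeSet]
  exact Finite.card_le_one_iff_subsingleton.2 hG.preconnected.subsingleton_connectedComponent

theorem le_ncard_add_one_of_ncomp_le_one {n : ℕ} (hn : 0 < n) {s : Set (Sym2 (Fin n))}
    (h : ncomp n s ≤ 1) : n ≤ s.ncard + 1 := by
  have hcard := (connected_fromEdgeSet_of_ncomp_le_one hn h).card_vert_le_card_edgeSet_add_one
  rw [Nat.card_fin, SimpleGraph.edgeSet_fromEdgeSet, Nat.card_coe_set_eq] at hcard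
  have hle : (s \ Sym2.diagSet).ncard ≤ s.ncard := Set.ncard_le_ncard Set.sdiff_subset s.toFinite
  omega

theorem Ncnt_one_eq_zero {n i : ℕ} (hn : 0 < n) (G : SimpleGraph (Fin n)) (hi : i + 1 < n) :
    Ncnt n G i 1 = 0 := by
  rw [Ncnt, Set.ncard_eq_zero (Set.toFinite _), Set.eq_empty_iff_forall_notMem]
  rintro s ⟨-, rfl, hs⟩
  have := le_ncard_add_one_of_ncomp_le_one hn hs
  omega

/-- The coefficient of `y ^ c` in the Whitney polynomial of a connected graph counts the connected
spanning subgraphs with corank `c`. -/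
theorem coeff_whitney_single_one {n i : ℕ} (hn : 0 < n) {G : SimpleGraph (Fin n)}
    (hG : G.Connected) (hi : n ≤ i + 1) :
    (whitney n G).coeff (Finsupp.single 1 (i + 1 - n)) = Ncnt n G i 1 := by
  classical
  have hterm (s : Set (Sym2 (Fin n))) :
      coeff (Finsupp.single 1 (i + 1 - n))
          (X 0 ^ (ncomp n s - ncomp n G.edgeSet) * X 1 ^ (s.ncard + ncomp n s - n) :
            MvPolynomial (Fin 2) ℝ) =
        if s.ncard = i ∧ ncomp n s ≤ 1 then 1 else 0 := by
    rw [X_pow_eq_monomial, X_pow_eq_monomial, monomial_mul, one_mul, coeff_monomial]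
    refine if_congr ?_ rfl rfl
    rw [ncomp_edgeSet_of_connected hn hG]
    have h1 := one_le_ncomp hn s
    have h2 := le_ncard_add_one_of_ncomp_le_one (s := s) hn
    simp only [Finsupp.ext_iff, Fin.forall_fin_two, Finsupp.add_apply, Finsupp.single_apply]
    simp only [Fin.isValue, if_true, zero_ne_one, one_ne_zero, if_false, add_zero, zero_add]
    constructor
    · rintro ⟨h3, h4⟩
      have := h2 (by omega)
      omega
    · rintro ⟨h3, h4⟩
      omega
  rw [whitney, finsum_mem_eq_finite_toFinset_sum _ (Set.toFinite _), coeff_sum,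
    Finset.sum_congr rfl fun s _ => hterm s, Finset.sum_boole, Ncnt,
    Set.ncard_eq_toFinset_card _ (Set.toFinite _)]
  congr 2
  ext s
  simp

theorem coeff_single_one_one_sub_mul (Q : MvPolynomial (Fin 2) ℝ) (c : ℕ) :
    ((1 - X 0 * X 1) * Q).coeff (Finsupp.single 1 c) = Q.coeff (Finsupp.single 1 c) := by
  rw [sub_mul, one_mul, coeff_sub, mul_assoc, coeff_X_mul', if_neg, sub_zero]
  simp

theorem WhitneyMaximum.zeroElement {n m : ℕ} {G : SimpleGraph (Fin n)} (hn : 0 < n)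
    (hG : G.Connected) (h : WhitneyMaximum n m G) : ZeroElement n m G := by
  intro H hH i _
  rcases lt_or_ge (i + 1) n with hi | hi
  · rw [Ncnt_one_eq_zero hn H hi]
    exact Nat.zero_le _
  · obtain ⟨Q, hQ, hsub⟩ := h H hH
    have hcoeff := congrArg (coeff (Finsupp.single 1 (i + 1 - n))) hsub
    rw [coeff_sub, coeff_whitney_single_one hn hG hi, coeff_whitney_single_one hn hH.1 hi,
      coeff_single_one_one_sub_mul] at hcoeff
    have hnonneg := hQ (Finsupp.single 1 (i + 1 - n))
    rw [← hcoeff, sub_nonneg] at hnonneg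
    exact_mod_cast hnonneg

/-- A 0-element is matched coefficientwise by any member of the class that is at least as reliable
at one interior point. -/
theorem ZeroElement.Ncnt_le_of_rel_le {n m : ℕ} {G H : SimpleGraph (Fin n)} {p : ℝ}
    (hG : ZeroElement n m G) (hH : IsCnm n m H) (hp : p ∈ Set.Ioo (0 : ℝ) 1)
    (hrel : rel n m G 1 p ≤ rel n m H 1 p) {i : ℕ} (hi : i ≤ m) :
    Ncnt n G i 1 ≤ Ncnt n H i 1 := by
  have hpos (j : ℕ) : 0 < p ^ j * (1 - p) ^ (m - j) :=
    mul_pos (pow_pos hp.1 _) (pow_pos (sub_pos.2 hp.2) _)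
  by_contra! hlt
  refine hrel.not_gt (Finset.sum_lt_sum (fun j hj => ?_) ⟨i, by simp; omega, ?_⟩)
  · simp only [mul_assoc]
    have hj' : j ≤ m := by simpa [Nat.lt_succ_iff] using hj
    exact mul_le_mul_of_nonneg_right (by exact_mod_cast hG H hH j hj') (hpos j).le
  · simp only [mul_assoc]
    exact mul_lt_mul_of_pos_right (by exact_mod_cast hlt) (hpos i)

/-- if a Whitney-maximum graph exists in `C_{n,m}`, then every uniformly
most reliable graph in `C_{n,m}` is a 0-element in `C_{n,m}`. -/
theorem stmt19 (n m : ℕ) (hn : 0 < n) (hm : 0 < m)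
    (hex : ∃ G : SimpleGraph (Fin n), IsCnm n m G ∧ WhitneyMaximum n m G) :
    ∀ H : SimpleGraph (Fin n), IsCnm n m H →
      (∀ H' : SimpleGraph (Fin n), IsCnm n m H' →
        ∀ p ∈ Set.Icc (0 : ℝ) 1, rel n m H' 1 p ≤ rel n m H 1 p) →
      ZeroElement n m H := by
  obtain ⟨G, hG, hmax⟩ := hex
  intro H hH hrel H' hH' i hi
  have hzero := hmax.zeroElement hn hG.1
  exact (hzero H' hH' i hi).trans (hzero.Ncnt_le_of_rel_le hH (p := 1 / 2) (by norm_num)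
    (hrel G hG _ (by norm_num)) hi)
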